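/- Let G be a countably infinite discrete group and (X,G) a nontrivial transitive G-system on a compact metric space which is disjoint from every minimal G-system. Then every transitive point x ∈ X is weakly product recurrent (for every G-system (Y,G) and every almost periodic point y ∈ Y, the pair (x,y) is recurrent in (X×Y,G)) but not product recurrent. -/

import Mathlib

/-- A subset `A` of a group `G` is syndetic if there is a finite `K ⊆ G` with `G = K⁻¹A`. -/
def Syndetic {G : Type*} [Group G] (A : Set G) : Prop :=
  ∃ K : Finset G, ∀ g : G, ∃ k ∈ K, k * g ∈ A

/-- A `G`-system: a continuous action of `G` on a compact metric space. -/
structure GSystem (G : Type*) [Group G] where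
  X : Type
  [ms : MetricSpace X]
  [cs : CompactSpace X]
  act : G → X → X
  act_one : ∀ x, act 1 x = x
  act_mul : ∀ g h x, act (g * h) x = act g (act h x)
  act_cont : ∀ g, Continuous (act g)

attribute [instance] GSystem.ms GSystem.cs

variable {G : Type*} [Group G]

/-- A point is transitive if its orbit is dense. -/
def IsTransitivePoint (S : GSystem G) (x : S.X) : Prop :=
  Dense (Set.range fun g : G => S.act g x)

/-- A system is minimal if every point is transitive. -/
def IsMinimal (S : GSystem G) : Prop :=
  ∀ x : S.X, IsTransitivePoint S x

/-- A point `y` is recurrent if every return time set is infinite. -/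
def IsRecurrentPoint (S : GSystem G) (y : S.X) : Prop :=
  ∀ V ∈ nhds y, {g : G | S.act g y ∈ V}.Infinite

/-- A point `y` is almost periodic if every return time set is syndetic. -/
def IsAlmostPeriodicPoint (S : GSystem G) (y : S.X) : Prop :=
  ∀ V ∈ nhds y, Syndetic {g : G | S.act g y ∈ V}

/-- `J` is a joining of `S` and `T`: a nonempty closed invariant subset of the product
projecting onto both factors. -/
def IsJoining (S T : GSystem G) (J : Set (S.X × T.X)) : Prop :=
  J.Nonempty ∧ IsClosed J ∧
  (∀ g : G, ∀ p ∈ J, (S.act g p.1, T.act g p.2) ∈ J) ∧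
  Prod.fst '' J = Set.univ ∧ Prod.snd '' J = Set.univ

/-- `S` and `T` are disjoint if the only joining is the full product. -/
def DisjointSystems (S T : GSystem G) : Prop :=
  ∀ J : Set (S.X × T.X), IsJoining S T J → J = Set.univ

/-- The pair `(x,y)` is recurrent in the product system. -/
def IsProductRecurrentPair (S T : GSystem G) (x : S.X) (y : T.X) : Prop :=
  ∀ W ∈ nhds ((x, y) : S.X × T.X), {g : G | (S.act g x, T.act g y) ∈ W}.Infinite

open Set Topology

namespace GSystem

/-- A set is invariant if the action maps it into itself. -/
def IsInvariant (S : GSystem G) (N : Set S.X) : Prop :=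
  ∀ g : G, ∀ p ∈ N, S.act g p ∈ N

/-- The closure of the orbit of a point. -/
def orbitClosure (S : GSystem G) (x : S.X) : Set S.X :=
  closure (range fun g : G => S.act g x)

theorem act_mem_orbitClosure (S : GSystem G) (g : G) (x : S.X) :
    S.act g x ∈ S.orbitClosure x :=
  subset_closure ⟨g, rfl⟩

theorem mem_orbitClosure_self (S : GSystem G) (x : S.X) : x ∈ S.orbitClosure x := by
  simpa [S.act_one] using S.act_mem_orbitClosure 1 x

theorem isInvariant_orbitClosure (S : GSystem G) (x : S.X) :
    S.IsInvariant (S.orbitClosure x) := by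
  intro g p hp
  refine map_mem_closure (S.act_cont g) hp ?_
  rintro _ ⟨h, rfl⟩
  exact ⟨g * h, S.act_mul g h x⟩

theorem IsInvariant.orbitClosure_subset {S : GSystem G} {N : Set S.X} (hN : S.IsInvariant N)
    (hc : IsClosed N) {p : S.X} (hp : p ∈ N) : S.orbitClosure p ⊆ N := by
  refine closure_minimal ?_ hc
  rintro _ ⟨g, rfl⟩
  exact hN g p hp

/-- The product system with the diagonal action. -/
def prod (S T : GSystem G) : GSystem G where
  X := S.X × T.X
  act g p := (S.act g p.1, T.act g p.2)
  act_one p := by simp [S.act_one, T.act_one]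
  act_mul g h p := by simp [S.act_mul, T.act_mul]
  act_cont g := ((S.act_cont g).comp continuous_fst).prodMk ((T.act_cont g).comp continuous_snd)

/-- The subsystem carried by a closed invariant set. -/
def restrict (S : GSystem G) (N : Set S.X) (hc : IsClosed N) (hN : S.IsInvariant N) :
    GSystem G where
  X := N
  cs := isCompact_iff_compactSpace.mp hc.isCompact
  act g p := ⟨S.act g p, hN g p p.2⟩
  act_one p := Subtype.ext (S.act_one p)
  act_mul g h p := Subtype.ext (S.act_mul g h p)
  act_cont g := ((S.act_cont g).comp continuous_subtype_val).subtype_mk _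

/-- The shift system `A ^ G`, with `G` enumerated by `ℕ`, under right translation of the
coordinates. -/
noncomputable def shift (e : G ≃ ℕ) (A : Type) [TopologicalSpace A] [CompactSpace A]
    [TopologicalSpace.MetrizableSpace A] : GSystem G where
  X := ℕ → A
  ms := TopologicalSpace.metrizableSpaceMetric (ℕ → A)
  cs := Function.compactSpace
  act g c n := c (e (e.symm n * g))
  act_one c := by simp
  act_mul g h c := by simp [mul_assoc]
  act_cont g := by
    change Continuous[Pi.topologicalSpace, Pi.topologicalSpace] _
    fun_prop

theorem exists_minimal_subset (S : GSystem G) {C : Set S.X} (hc : IsClosed C)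
    (hC : S.IsInvariant C) (hne : C.Nonempty) :
    ∃ N ⊆ C, IsClosed N ∧ S.IsInvariant N ∧ N.Nonempty ∧ ∀ p ∈ N, S.orbitClosure p = N := by
  let F : Set (Set S.X) := {N | IsClosed N ∧ S.IsInvariant N ∧ N.Nonempty}
  obtain ⟨N, hNC, hN⟩ := zorn_superset_nonempty F (by
    intro c hcF hchain hcne
    have : Nonempty c := hcne.to_subtype
    refine ⟨⋂₀ c, ⟨isClosed_sInter fun s hs => (hcF hs).1, ?_, ?_⟩, fun s hs =>
      sInter_subset_of_mem hs⟩
    · intro g p hp s hs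
      exact (hcF hs).2.1 g p (hp s hs)
    · exact IsCompact.nonempty_sInter_of_directed_nonempty_isCompact_isClosed
        (fun a ha b hb => (hchain.total ha hb).elim (fun h => ⟨a, ha, subset_rfl, h⟩)
          (fun h => ⟨b, hb, h, subset_rfl⟩)) (fun s hs => (hcF hs).2.2)
        (fun s hs => (hcF hs).1.isCompact) (fun s hs => (hcF hs).1)) C ⟨hc, hC, hne⟩
  refine ⟨N, hNC, hN.prop.1, hN.prop.2.1, hN.prop.2.2, fun p hp => ?_⟩
  exact hN.eq_of_subset
    ⟨isClosed_closure, S.isInvariant_orbitClosure p, ⟨p, S.mem_orbitClosure_self p⟩⟩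
    (hN.prop.2.1.orbitClosure_subset hN.prop.1 hp)

theorem isMinimal_restrict {S : GSystem G} {N : Set S.X} (hc : IsClosed N)
    (hN : S.IsInvariant N) (h : ∀ p ∈ N, S.orbitClosure p = N) :
    IsMinimal (S.restrict N hc hN) := by
  intro p
  change Dense (range fun g : G => (⟨S.act g p.1, hN g p.1 p.2⟩ : N))
  rw [Subtype.dense_iff]
  intro q hq
  rw [← range_comp]
  exact (h p.1 p.2).superset hq

end GSystem

open GSystem

theorem Syndetic.infinite [Infinite G] {A : Set G} (hA : Syndetic A) : A.Infinite := by
  obtain ⟨K, hK⟩ := hA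
  intro hfin
  refine infinite_univ (α := G) ((K.finite_toSet.biUnion fun k _ =>
    hfin.preimage (mul_right_injective k).injOn).subset fun g _ => ?_)
  obtain ⟨k, hk, hg⟩ := hK g
  exact mem_biUnion (s := (K : Set G)) (t := fun k => (fun g => k * g) ⁻¹' A) hk hg

theorem IsAlmostPeriodicPoint.mem_orbitClosure {T : GSystem G} {y q : T.X}
    (hy : IsAlmostPeriodicPoint T y) (hq : q ∈ T.orbitClosure y) : y ∈ T.orbitClosure q := by
  refine mem_closure_iff_nhds.mpr fun V hV => ?_
  obtain ⟨D, hD, hDc, hDV⟩ := exists_mem_nhds_isClosed_subset hV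
  obtain ⟨K, hK⟩ := hy D hD
  have hcl : IsClosed (⋃ k ∈ K, T.act k ⁻¹' D) :=
    isClosed_biUnion_finset fun k _ => hDc.preimage (T.act_cont k)
  have hsub : T.orbitClosure y ⊆ ⋃ k ∈ K, T.act k ⁻¹' D := by
    refine closure_minimal ?_ hcl
    rintro _ ⟨g, rfl⟩
    obtain ⟨k, hk, hg⟩ := hK g
    refine mem_biUnion hk ?_
    simpa [T.act_mul] using hg
  obtain ⟨k, _, hk⟩ := mem_iUnion₂.mp (hsub hq)
  exact ⟨T.act k q, hDV hk, k, rfl⟩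

theorem IsMinimal.syndetic {T : GSystem G} (hT : IsMinimal T) {V : Set T.X}
    (hV : IsOpen V) (hne : V.Nonempty) (p : T.X) : Syndetic {g : G | T.act g p ∈ V} := by
  obtain ⟨K, hK⟩ := isCompact_univ.elim_finite_subcover (fun g : G => T.act g ⁻¹' V)
    (fun g => hV.preimage (T.act_cont g)) (fun q _ => by
      obtain ⟨_, hv, g, rfl⟩ := (hT q).inter_open_nonempty V hV hne
      exact mem_iUnion.mpr ⟨g, hv⟩)
  refine ⟨K, fun g => ?_⟩
  obtain ⟨k, hk, hg⟩ := mem_iUnion₂.mp (hK (mem_univ (T.act g p)))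
  exact ⟨k, hk, by simpa [T.act_mul] using hg⟩

theorem IsAlmostPeriodicPoint.isMinimal {S : GSystem G} {x : S.X}
    (hap : IsAlmostPeriodicPoint S x) (hx : IsTransitivePoint S x) : IsMinimal S := by
  intro q
  have hxq : x ∈ S.orbitClosure q := hap.mem_orbitClosure (hx q)
  exact fun p => (S.isInvariant_orbitClosure q).orbitClosure_subset isClosed_closure hxq (hx p)

theorem DisjointSystems.not_self {S : GSystem G} (h : DisjointSystems S S)
    (hnt : ∃ a b : S.X, a ≠ b) : False := by
  obtain ⟨a, b, hab⟩ := hnt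
  have := h (diagonal S.X) ⟨⟨(a, a), rfl⟩, isClosed_diagonal, fun g p hp => by
      rw [mem_diagonal_iff] at hp ⊢
      simp [hp], eq_univ_of_forall fun p => ⟨(p, p), rfl, rfl⟩,
    eq_univ_of_forall fun p => ⟨(p, p), rfl, rfl⟩⟩
  exact hab (this.symm ▸ mem_univ (a, b) : (a, b) ∈ diagonal S.X)

theorem DisjointSystems.isTransitivePoint_prod {S T : GSystem G} (h : DisjointSystems S T)
    {x : S.X} {y : T.X} (hx : IsTransitivePoint S x) (hy : IsTransitivePoint T y) :
    IsTransitivePoint (S.prod T) (x, y) := by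
  have hJ := h ((S.prod T).orbitClosure (x, y))
    ⟨⟨_, (S.prod T).mem_orbitClosure_self (x, y)⟩, isClosed_closure,
      (S.prod T).isInvariant_orbitClosure (x, y), ?_, ?_⟩
  · exact fun p => (hJ.symm ▸ mem_univ p : p ∈ (S.prod T).orbitClosure (x, y))
  · have hc : IsClosed (Prod.fst '' (S.prod T).orbitClosure (x, y)) :=
      (isClosed_closure.isCompact.image continuous_fst).isClosed
    refine eq_univ_of_univ_subset (hx.closure_eq ▸ closure_minimal ?_ hc)
    rintro _ ⟨g, rfl⟩
    exact ⟨_, (S.prod T).act_mem_orbitClosure g (x, y), rfl⟩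
  · have hc : IsClosed (Prod.snd '' (S.prod T).orbitClosure (x, y)) :=
      (isClosed_closure.isCompact.image continuous_snd).isClosed
    refine eq_univ_of_univ_subset (hy.closure_eq ▸ closure_minimal ?_ hc)
    rintro _ ⟨g, rfl⟩
    exact ⟨_, (S.prod T).act_mem_orbitClosure g (x, y), rfl⟩

theorem Fin.exists_ne_and_ne_of_three (a b : Fin 3) : ∃ c : Fin 3, c ≠ a ∧ c ≠ b := by
  revert a b
  decide

/-- The greedy colouring of `ℕ` along the edges `n — f n`. -/
noncomputable def greedyColoring (f : ℕ ≃ ℕ) (n : ℕ) : Fin 3 :=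
  Classical.choose (Fin.exists_ne_and_ne_of_three
    (if _h : f n < n then greedyColoring f (f n) else 0)
    (if _h : f.symm n < n then greedyColoring f (f.symm n) else 0))

theorem greedyColoring_ne (f : ℕ ≃ ℕ) {n : ℕ} (hn : f n ≠ n) :
    greedyColoring f (f n) ≠ greedyColoring f n := by
  have key : ∀ m : ℕ, (f m < m → greedyColoring f m ≠ greedyColoring f (f m)) ∧
      (f.symm m < m → greedyColoring f m ≠ greedyColoring f (f.symm m)) := by
    intro m
    have := Classical.choose_spec (Fin.exists_ne_and_ne_of_three
      (if _h : f m < m then greedyColoring f (f m) else 0)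
      (if _h : f.symm m < m then greedyColoring f (f.symm m) else 0))
    rw [← greedyColoring] at this
    refine ⟨fun h => ?_, fun h => ?_⟩
    · simpa [h] using this.1
    · simpa [h] using this.2
  rcases lt_or_gt_of_ne hn with h | h
  · exact ((key n).1 h).symm
  · simpa using (key (f n)).2 (by simpa using h)

/-- There is a nonempty system on which the group acts freely. -/
theorem exists_free_system [Countable G] [Infinite G] :
    ∃ T : GSystem G, Nonempty T.X ∧ ∀ (z : T.X) (g : G), T.act g z = z → g = 1 := by
  obtain ⟨e⟩ : Nonempty (G ≃ ℕ) := by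
    obtain ⟨_⟩ := nonempty_denumerable G
    exact ⟨Denumerable.eqv G⟩
  let T := shift e (ℕ → Fin 3)
  let C : Set (ℕ → ℕ → Fin 3) :=
    {c | ∀ g : G, g ≠ 1 → ∀ h : G, c (e (g * h)) (e g) ≠ c (e h) (e g)}
  have hC : T.IsInvariant C := by
    intro a c hc g hg h
    simpa [T, shift, mul_assoc] using hc g hg (h * a)
  have hCc : IsClosed C := by
    simp only [C, ofPred_forall]
    refine isClosed_iInter fun g => isClosed_iInter fun _ => isClosed_iInter fun h => ?_
    have hcont : Continuous fun c : ℕ → ℕ → Fin 3 => (c (e (g * h)) (e g), c (e h) (e g)) := by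
      fun_prop
    exact (isClosed_discrete {p : Fin 3 × Fin 3 | p.1 ≠ p.2}).preimage hcont
  refine ⟨T.restrict C hCc hC, ⟨⟨fun m k => greedyColoring
    ((e.symm.trans (Equiv.mulLeft (e.symm k))).trans e) m, ?_⟩⟩, ?_⟩
  · intro g hg h
    have := greedyColoring_ne ((e.symm.trans (Equiv.mulLeft g)).trans e) (n := e h)
      (by simpa using hg)
    simpa using this
  · intro z g hz
    by_contra hg
    have h1 : T.act g z.1 = z.1 := congrArg Subtype.val hz
    have h2 := z.2 g hg 1
    have h3 := congrFun (congrFun h1 (e 1)) (e g)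
    simp [T, shift] at h3
    simp [h3] at h2

/-- A free minimal system of an infinite group has no nonempty finite open set. -/
theorem IsMinimal.infinite_of_isOpen [Infinite G] {T : GSystem G} (hT : IsMinimal T)
    (hfree : ∀ (z : T.X) (g : G), T.act g z = z → g = 1) {V : Set T.X} (hV : IsOpen V)
    (hne : V.Nonempty) : V.Infinite := by
  obtain ⟨p, _⟩ := id hne
  have hinj : Function.Injective fun g : G => T.act g p := by
    intro g h hgh
    have : T.act (h⁻¹ * g) p = p := by
      rw [T.act_mul, show T.act g p = T.act h p from hgh, ← T.act_mul, inv_mul_cancel, T.act_one]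
    exact (inv_mul_eq_one.mp (hfree p _ this)).symm
  intro hfin
  exact (hT.syndetic hV hne p).infinite (hfin.preimage hinj.injOn)

theorem IsTransitivePoint.infinite_of_isOpen {T : GSystem G} {p : T.X}
    (hp : IsTransitivePoint T p) {W : Set T.X} (hW : IsOpen W) (hinf : W.Infinite) :
    {g : G | T.act g p ∈ W}.Infinite := by
  intro hfin
  have hfin' := hfin.image fun g => T.act g p
  obtain ⟨_, ⟨hw, hn⟩, g, rfl⟩ := hp.inter_open_nonempty _ (hW.sdiff hfin'.isClosed)
    (hinf.sdiff hfin').nonempty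
  exact hn ⟨g, hw, rfl⟩

theorem exists_free_minimal_extension [Countable G] [Infinite G] {T : GSystem G} {y : T.X}
    (hy : IsAlmostPeriodicPoint T y) :
    ∃ (R : GSystem G) (π : R.X → T.X) (r : R.X), IsMinimal R ∧
      (∀ (z : R.X) (g : G), R.act g z = z → g = 1) ∧ Continuous π ∧
      (∀ g z, π (R.act g z) = T.act g (π z)) ∧ π r = y := by
  obtain ⟨Z, ⟨z₀⟩, hfree⟩ := exists_free_system (G := G)
  have hCc : IsClosed (Prod.fst ⁻¹' T.orbitClosure y : Set (T.prod Z).X) :=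
    isClosed_closure.preimage continuous_fst
  obtain ⟨N, hNC, hNc, hN, ⟨p, hp⟩, hmin⟩ := (T.prod Z).exists_minimal_subset
    (C := Prod.fst ⁻¹' T.orbitClosure y) hCc
    (fun g p hp => T.isInvariant_orbitClosure y g p.1 hp) ⟨(y, z₀), T.mem_orbitClosure_self y⟩
  have hπc : IsClosed (Prod.fst '' N : Set T.X) := (hNc.isCompact.image continuous_fst).isClosed
  have hπ : T.IsInvariant (Prod.fst '' N) := by
    rintro g _ ⟨q, hq, rfl⟩
    exact ⟨_, hN g q hq, rfl⟩
  obtain ⟨r, hr, hry⟩ : y ∈ (Prod.fst '' N : Set T.X) :=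
    hπ.orbitClosure_subset hπc ⟨p, hp, rfl⟩ (hy.mem_orbitClosure (hNC hp))
  refine ⟨(T.prod Z).restrict N hNc hN, fun q => q.1.1, ⟨r, hr⟩, isMinimal_restrict hNc hN hmin,
    fun q g hq => hfree q.1.2 g ?_, continuous_fst.comp continuous_subtype_val,
    fun g q => rfl, hry⟩
  exact congrArg (fun q : N => q.1.2) hq

theorem isProductRecurrentPair_of_disjoint_minimal [Countable G] [Infinite G] {S : GSystem G}
    (hdisj : ∀ T : GSystem G, IsMinimal T → DisjointSystems S T) {x : S.X}
    (hx : IsTransitivePoint S x) {T : GSystem G} {y : T.X} (hy : IsAlmostPeriodicPoint T y) :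
    IsProductRecurrentPair S T x y := by
  obtain ⟨R, π, r, hmin, hfree, hπc, hπ, rfl⟩ := exists_free_minimal_extension hy
  intro W hW
  obtain ⟨U, hU, hxU, V, hV, hyV, hUV⟩ : ∃ U : Set S.X, IsOpen U ∧ x ∈ U ∧
      ∃ V : Set T.X, IsOpen V ∧ π r ∈ V ∧ U ×ˢ V ⊆ W := by
    obtain ⟨U, V, hU, hxU, hV, hyV, h⟩ := mem_nhds_prod_iff'.mp hW
    exact ⟨U, hU, hxU, V, hV, hyV, h⟩
  have hV' : (π ⁻¹' V).Infinite := hmin.infinite_of_isOpen hfree (hV.preimage hπc) ⟨r, hyV⟩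
  have htr := (hdisj R hmin).isTransitivePoint_prod hx (hmin r)
  refine (htr.infinite_of_isOpen (W := U ×ˢ (π ⁻¹' V)) (hU.prod (hV.preimage hπc))
    (hV'.prod_right ⟨x, hxU⟩)).mono fun g hg => hUV ⟨hg.1, ?_⟩
  exact hπ g r ▸ hg.2

/-- In an infinite group, a finite set has arbitrarily far translates missing a non-syndetic
set. -/
theorem exists_notMem_forall_mul_notMem [Infinite G] {A : Set G} (hA : ¬ Syndetic A)
    (B E : Finset G) : ∃ g ∉ E, ∀ b ∈ B, b * g ∉ A := by
  classical
  obtain ⟨L, hL⟩ := Infinite.exists_subset_card_eq G (E.card + 1)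
  simp only [Syndetic, not_exists, not_forall, not_and] at hA
  obtain ⟨g, hg⟩ := hA (Finset.image₂ (· * ·) B L)
  obtain ⟨l, hl, hlE⟩ : ∃ l ∈ L, l * g ∉ E := by
    by_contra! h
    have := Finset.card_le_card_of_injOn (fun l => l * g) h (mul_left_injective g).injOn
    omega
  refine ⟨l * g, hlE, fun b hb => ?_⟩
  rw [← mul_assoc]
  exact hg _ (Finset.mem_image₂_of_mem hb hl)

/-- The complement of a non-syndetic set contains, up to the identity, a set whose indicator
function is recurrent under right translation. -/
theorem exists_recurrent_set [Countable G] [Infinite G] {A : Set G} (hA : ¬ Syndetic A) :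
    ∃ B : Set G, 1 ∈ B ∧ (∀ b ∈ B, b ∈ A → b = 1) ∧
      ∀ K : Finset G, {g : G | ∀ k ∈ K, k * g ∈ B ↔ k ∈ B}.Infinite := by
  classical
  obtain ⟨u, hu⟩ := exists_surjective_nat G
  choose t htE htA using exists_notMem_forall_mul_notMem hA
  let τ : Finset G × Finset G → G := fun P =>
    t P.1 (Finset.image₂ (fun a b => a⁻¹ * b) P.2 P.2)
  let P : ℕ → Finset G × Finset G := fun n => Nat.rec ({1}, {1}) (fun n P =>
    (P.1 ∪ P.1.image (· * τ P), insert (u n) (P.2 ∪ P.2.image (· * τ P)))) n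
  let B : ℕ → Finset G := fun n => (P n).1
  let F : ℕ → Finset G := fun n => (P n).2
  let s : ℕ → G := fun n => τ (P n)
  have hB : ∀ n, B (n + 1) = B n ∪ (B n).image (· * s n) := fun n => rfl
  have hF : ∀ n, F (n + 1) = insert (u n) (F n ∪ (F n).image (· * s n)) := fun n => rfl
  have hsA : ∀ n, ∀ b ∈ B n, b * s n ∉ A := fun n => htA _ _
  have hsF : ∀ n, ∀ a ∈ F n, a * s n ∉ F n := by
    intro n a ha h
    exact htE (P n).1 (Finset.image₂ (fun a b => a⁻¹ * b) (P n).2 (P n).2)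
      (Finset.mem_image₂.mpr ⟨a, ha, a * s n, h, inv_mul_cancel_left a (s n)⟩)
  have hFmono : Monotone F := monotone_nat_of_le_succ fun n a ha => by
    rw [hF]; simp [ha]
  have hBmono : Monotone B := monotone_nat_of_le_succ fun n a ha => by
    rw [hB]; simp [ha]
  have hBF : ∀ n, B n ⊆ F n := by
    intro n
    induction n with
    | zero => exact subset_rfl
    | succ n ih =>
      rw [hB, hF]
      exact (Finset.union_subset_union ih (Finset.image_subset_image ih)).trans
        (Finset.subset_insert _ _)
  have h1 : ∀ n, 1 ∈ B n := fun n => hBmono (Nat.zero_le n) (Finset.mem_singleton_self 1)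
  have hstable : ∀ n m, ∀ a ∈ F n, a ∈ B m → a ∈ B n := by
    intro n m a ha
    induction m with
    | zero => exact fun h => hBmono (Nat.zero_le n) h
    | succ m ih =>
      intro h
      rcases le_or_gt (m + 1) n with hmn | hmn
      · exact hBmono hmn h
      · rw [hB, Finset.mem_union, Finset.mem_image] at h
        rcases h with h | ⟨b, hb, rfl⟩
        · exact ih h
        · exact absurd (hFmono (Nat.lt_succ_iff.mp hmn) ha) (hsF m b (hBF m hb))
  have hexh : ∀ K : Finset G, ∃ n, K ⊆ F n := by
    intro K
    induction K using Finset.induction_on with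
    | empty => exact ⟨0, Finset.empty_subset _⟩
    | insert a K _ ih =>
      obtain ⟨n, hn⟩ := ih
      obtain ⟨m, rfl⟩ := hu a
      refine ⟨max n (m + 1), Finset.insert_subset (hFmono (le_max_right n (m + 1)) ?_)
        (hn.trans (hFmono (le_max_left _ _)))⟩
      rw [hF]; simp
  refine ⟨⋃ n, (B n : Set G), mem_iUnion.mpr ⟨0, h1 0⟩, ?_, fun K hfin => ?_⟩
  · intro b hb hbA
    obtain ⟨n, hn⟩ := mem_iUnion.mp hb
    rw [Finset.mem_coe] at hn
    induction n with
    | zero => exact Finset.mem_singleton.mp hn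
    | succ n ih =>
      rw [hB, Finset.mem_union, Finset.mem_image] at hn
      rcases hn with h | ⟨a, ha, rfl⟩
      · exact ih h
      · exact absurd hbA (hsA n a ha)
  · obtain ⟨n, hn⟩ := hexh (K ∪ hfin.toFinset)
    have hs : s n ∉ F n := by simpa using hsF n 1 (hBF n (h1 n))
    refine hs (hn (Finset.mem_union_right _ (hfin.mem_toFinset.mpr fun k hk => ?_)))
    have hkF : k ∈ F n := hn (Finset.mem_union_left _ hk)
    simp only [mem_iUnion, Finset.mem_coe]
    refine ⟨fun ⟨m, hm⟩ => ⟨n, ?_⟩, fun ⟨m, hm⟩ => ⟨n + 1, ?_⟩⟩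
    · have hmem : k * s n ∈ F (n + 1) := by
        rw [hF]
        exact Finset.mem_insert_of_mem
          (Finset.mem_union_right _ (Finset.mem_image_of_mem _ hkF))
      have := hstable (n + 1) m _ hmem hm
      rw [hB, Finset.mem_union, Finset.mem_image] at this
      rcases this with h | ⟨b, hb, hbk⟩
      · exact absurd (hBF n h) (hsF n k hkF)
      · exact mul_right_cancel hbk ▸ hb
    · rw [hB]
      exact Finset.mem_union_right _ (Finset.mem_image_of_mem _ (hstable n m k hkF hm))

/-- Every point recurrent in product with all recurrent points is almost periodic. -/
theorem isAlmostPeriodicPoint_of_forall_isProductRecurrentPair [Countable G] [Infinite G]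
    {S : GSystem G} {x : S.X}
    (h : ∀ T : GSystem G, ∀ y : T.X, IsRecurrentPoint T y → IsProductRecurrentPair S T x y) :
    IsAlmostPeriodicPoint S x := by
  classical
  by_contra hap
  simp only [IsAlmostPeriodicPoint, not_forall] at hap
  obtain ⟨U, hU, hA⟩ := hap
  obtain ⟨B, h1, hBA, hrec⟩ := exists_recurrent_set hA
  obtain ⟨e⟩ : Nonempty (G ≃ ℕ) := by
    obtain ⟨_⟩ := nonempty_denumerable G
    exact ⟨Denumerable.eqv G⟩
  let y : ℕ → Bool := fun n => decide (e.symm n ∈ B)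
  have hbasis : ∀ V : Set (ℕ → Bool), V ∈ 𝓝 y →
      ∃ I : Set ℕ, I.Finite ∧ ∃ v : ℕ → Set Bool, (∀ n, v n ∈ 𝓝 (y n)) ∧ I.pi v ⊆ V := by
    intro V hV
    rwa [nhds_pi, Filter.mem_pi] at hV
  have hy : IsRecurrentPoint (shift e Bool) y := by
    intro V hV
    obtain ⟨I, hI, v, hv, hIV⟩ := hbasis V hV
    refine (hrec (hI.toFinset.image e.symm)).mono fun g hg => hIV fun n hn => ?_
    have := hg (e.symm n) (Finset.mem_image_of_mem _ (hI.mem_toFinset.mpr hn))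
    have heq : (shift e Bool).act g y n = y n := by
      simp [shift, y, this]
    exact heq.symm ▸ mem_of_mem_nhds (hv n)
  have hV : {c : ℕ → Bool | c (e 1) = true} ∈ @nhds (ℕ → Bool) Pi.topologicalSpace y := by
    have hcont : Continuous fun c : ℕ → Bool => c (e 1) := continuous_apply (e 1)
    exact hcont.continuousAt.preimage_mem_nhds ((isOpen_discrete {true}).mem_nhds (by simpa [y]))
  refine (h (shift e Bool) y hy _ (prod_mem_nhds hU hV)) ((finite_singleton 1).subset ?_)
  rintro g ⟨hgU, hgV⟩
  refine hBA g ?_ hgU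
  have hgB : y (e (e.symm (e 1) * g)) = true := hgV
  simpa [y] using hgB

/-- If a nontrivial transitive `G`-system is disjoint from every minimal system, then every
transitive point is weakly product recurrent but not product recurrent. -/
theorem weakly_product_recurrent_not_product_recurrent
    [Countable G] [Infinite G]
    (S : GSystem G) (hnt : ∃ a b : S.X, a ≠ b)
    (htrans : ∃ z : S.X, IsTransitivePoint S z)
    (hdisj : ∀ T : GSystem G, IsMinimal T → DisjointSystems S T)
    (x : S.X) (hx : IsTransitivePoint S x) :
    (∀ T : GSystem G, ∀ y : T.X, IsAlmostPeriodicPoint T y →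
        IsProductRecurrentPair S T x y) ∧
    ¬ (∀ T : GSystem G, ∀ y : T.X, IsRecurrentPoint T y →
        IsProductRecurrentPair S T x y) := by
  refine ⟨fun T y hy => isProductRecurrentPair_of_disjoint_minimal hdisj hx hy, fun h => ?_⟩
  have hmin := (isAlmostPeriodicPoint_of_forall_isProductRecurrentPair h).isMinimal hx
  exact (hdisj S hmin).not_self hnt
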